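/- arXiv:1504.06916 — 2 statements merged into one kernel-verified Lean document; each statement's English description precedes it below -/
import Mathlib

section
/- Let s_i > n/2 for 1 ≤ i ≤ m, and let ζ̂ be a smooth function on ℝ^{mn} supported in an annulus centered at the origin. Suppose Φ is a function on ℝ^{mn} smooth away from zero satisfying |∂_ξ^α Φ(ξ)| ≤ C_α |ξ|^{−|α|} for all ξ ≠ 0 and all multi-indices α. Then there exists a constant C such that for every bounded function σ on ℝ^{mn}, sup_{j∈ℤ} ‖σ(2^j·)Φ(2^j·)ζ̂‖_{W^{(s_1,…,s_m)}} ≤ C·sup_{j∈ℤ} ‖σ(2^j·)ψ̂‖_{W^{(s_1,…,s_m)}}. -/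
open MeasureTheory Real Metric Set Function SchwartzMap
open scoped ENNReal NNReal FourierTransform RealInnerProductSpace BigOperators

noncomputable section

abbrev Rn (n : ℕ) : Type := EuclideanSpace ℝ (Fin n)
abbrev Rmn (m n : ℕ) : Type := EuclideanSpace ℝ (Fin m × Fin n)

namespace MLFM

variable {m n : ℕ}

/-- The `i`-th `ℝⁿ`-component of a point of `ℝ^{mn}`. -/
def proj (ξ : Rmn m n) (i : Fin m) : Rn n :=
  (EuclideanSpace.equiv (Fin n) ℝ).symm fun j => ξ (i, j)

/-- Assemble a point of `ℝ^{mn}` from `m` points of `ℝⁿ`. -/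
def toRmn (g : Fin m → Rn n) : Rmn m n :=
  (EuclideanSpace.equiv (Fin m × Fin n) ℝ).symm fun c => g c.1 c.2

/-- `σ` is a bounded function. -/
def Bdd {α : Type*} (σ : α → ℂ) : Prop := ∃ M : ℝ, ∀ ξ, ‖σ ξ‖ ≤ M

/-- Product-type Sobolev norm `W^{(s_1,…,s_m)}`. -/
def sobW (s : Fin m → ℝ) (f : Rmn m n → ℂ) : ℝ≥0∞ :=
  eLpNorm (fun y : Rmn m n =>
    (∏ i, ((1 : ℝ) + ‖proj y i‖ ^ 2) ^ (s i / 2)) * ‖𝓕 f y‖) 2 volume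

/-- `sup_j ‖σ(2^j ·) ψ̂‖_{W^{(s_1,…,s_m)}}`, where `ψ̂ = 𝓕 ψ`. -/
def mulBound (s : Fin m → ℝ) (ψ : 𝓢(Rmn m n, ℂ)) (σ : Rmn m n → ℂ) : ℝ≥0∞ :=
  ⨆ j : ℤ, sobW s fun ξ => σ ((2 : ℝ) ^ j • ξ) * 𝓕 (⇑ψ) ξ

/-- `ψ` generates a Littlewood–Paley partition of unity. -/
def IsLP (m n : ℕ) (ψ : 𝓢(Rmn m n, ℂ)) : Prop :=
  (∀ ξ : Rmn m n, 𝓕 (⇑ψ) ξ ≠ 0 → (1:ℝ)/2 ≤ ‖ξ‖ ∧ ‖ξ‖ ≤ 2) ∧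
  ∀ ξ : Rmn m n, ξ ≠ 0 → HasSum (fun j : ℤ => 𝓕 (⇑ψ) ((2 : ℝ) ^ (-j) • ξ)) 1

/-- The `m`-linear Fourier multiplier operator. -/
def Tmul (σ : Rmn m n → ℂ) (f : Fin m → Rn n → ℂ) (x : Rn n) : ℂ :=
  ∫ ξ : Rmn m n,
    Complex.exp (2 * (π : ℂ) * Complex.I * ((@inner ℝ _ _ x (∑ i, proj ξ i) : ℝ) : ℂ)) * σ ξ *
      ∏ i, 𝓕 (f i) (proj ξ i)

/-- Dilated Gaussian approximate identity. -/
def gaussKer (n : ℕ) (t : ℝ) (x : Rn n) : ℝ :=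
  t ^ (-(n : ℤ)) * Real.exp (-π * ‖x‖ ^ 2 / t ^ 2)

/-- Smooth (Gaussian) maximal function. -/
def hMax (f : Rn n → ℂ) (x : Rn n) : ℝ≥0∞ :=
  ⨆ t : {t : ℝ // 0 < t}, (‖∫ y : Rn n, gaussKer n t.1 (x - y) • f y‖₊ : ℝ≥0∞)

/-- Hardy space (quasi-)norm; for `p > 1` it is equivalent to the `L^p` norm. -/
def hNorm (p : ℝ≥0∞) (f : Rn n → ℂ) : ℝ≥0∞ :=
  if p = ∞ then essSup (hMax f) volume
  else (∫⁻ x : Rn n, hMax f x ^ p.toReal) ^ (1 / p.toReal)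

/-- BMO seminorm. -/
def bmo (f : Rn n → ℂ) : ℝ≥0∞ :=
  ⨆ (x : Rn n) (r : {r : ℝ // 0 < r}),
    (volume (ball x r.1))⁻¹ * ∫⁻ y in ball x r.1, (‖f y - ⨍ z in ball x r.1, f z‖₊ : ℝ≥0∞)

/-- Weak `L^p` quasinorm. -/
def wNorm (p : ℝ≥0∞) (g : Rn n → ℂ) : ℝ≥0∞ :=
  ⨆ t : {t : ℝ // 0 < t},
    ENNReal.ofReal t.1 * volume {x : Rn n | t.1 < ‖g x‖} ^ (1 / p.toReal)

/-- The axis-parallel cube with center `c` and sidelength `h`. -/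
def cube (c : Rn n) (h : ℝ) : Set (Rn n) := {x | ∀ i, |x i - c i| ≤ h / 2}

/-- The cube dilated by the factor `2√n`. -/
def cubeStar (c : Rn n) (h : ℝ) : Set (Rn n) := cube c (2 * Real.sqrt n * h)

/-- `a` is an `L^∞`-atom for `H^p` adapted to the cube with center `c` and side `h`,
with vanishing moments of order `< N`. -/
def IsAtom (p : ℝ≥0∞) (N : ℕ) (c : Rn n) (h : ℝ) (a : Rn n → ℂ) : Prop :=
  Function.support a ⊆ cube c h ∧
  (∀ x, ‖a x‖ ≤ ((h : ℝ) ^ n) ^ (-(p⁻¹.toReal))) ∧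
  ∀ γ : Fin n → ℕ, (∑ i, γ i) < N →
    (∫ x : Rn n, (∏ i, ((x i : ℂ) ^ γ i)) * a x) = 0

/-- Multilinear convolution operator with kernel `K`. -/
def TK (K : Rmn m n → ℂ) (f : Fin m → Rn n → ℂ) (x : Rn n) : ℂ :=
  ∫ y : Rmn m n, K (toRmn fun i => x - proj y i) * ∏ i, f i (proj y i)

/-- `k`-th "extended coordinate": for `k < m` the `k`-th component, for `k = m` the sum of all. -/
def coordE (m n : ℕ) (ξ : Rmn m n) (k : ℕ) : Rn n :=
  if h : k < m then proj ξ ⟨k, h⟩ else ∑ i, proj ξ i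

/-- The cone `Γ(V(k₁,k₂))` determined by the aperture `a`. -/
def coneSet (m n : ℕ) (a : ℝ) (k₁ k₂ : ℕ) : Set (Rmn m n) :=
  {ξ | ξ ≠ 0 ∧ a * ‖ξ‖ < ‖coordE m n ξ k₁‖ ∧ a * ‖ξ‖ < ‖coordE m n ξ k₂‖}

/-- Square function `GT_σ`. -/
def GT (ψ : 𝓢(Rmn m n, ℂ)) (σ : Rmn m n → ℂ) (f : Fin m → Rn n → ℂ) (x : Rn n) : ℝ :=
  Real.sqrt (∑' j : ℤ, ‖Tmul (fun ξ => σ ξ * 𝓕 (⇑ψ) ((2 : ℝ) ^ (-j) • ξ)) f x‖ ^ 2)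

/-- Littlewood–Paley piece `Δ_j f = (φ(2^{-j}·) f̂)^∨`, realized as a convolution. -/
def Delta (φ : 𝓢(Rn n, ℂ)) (j : ℤ) (f : Rn n → ℂ) (x : Rn n) : ℂ :=
  ∫ y : Rn n, (((2 : ℝ) ^ j) ^ n : ℝ) • ((𝓕⁻ (⇑φ)) ((2 : ℝ) ^ j • (x - y)) * f y)

/-- The weight `ζ_j(x) = 2^{jn}(1+|2^j x|)^{-e}`. -/
def zeta (n : ℕ) (e : ℝ) (j : ℤ) (x : Rn n) : ℝ :=
  ((2 : ℝ) ^ j) ^ n * (1 + ‖(2 : ℝ) ^ j • x‖) ^ (-e)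

/-- Partial derivative along the coordinate `c`. -/
def pd (c : Fin m × Fin n) (f : Rmn m n → ℂ) (y : Rmn m n) : ℂ :=
  fderiv ℝ f y (EuclideanSpace.single c 1)

/-- Multi-index partial derivative `∂^α`. -/
def pdMulti (α : Fin m × Fin n → ℕ) (f : Rmn m n → ℂ) : Rmn m n → ℂ :=
  (Finset.univ : Finset (Fin m × Fin n)).toList.foldr (fun c g => (pd c)^[α c] g) f

/-- Splice: the first `l` variables come from `w`, the rest from `y`. -/
def splice {l : ℕ} (_hlm : l ≤ m) (w : Rmn l n) (y : Rmn m n) : Rmn m n :=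
  (EuclideanSpace.equiv (Fin m × Fin n) ℝ).symm fun c =>
    if h : (c.1 : ℕ) < l then w (⟨(c.1 : ℕ), h⟩, c.2) else y c

end MLFM


open MLFM

namespace MLFM

variable {m n : ℕ}

/-- The product-type Sobolev weight `⟨y_1⟩^{s_1} ⋯ ⟨y_m⟩^{s_m}`. -/
def prodWeight (s : Fin m → ℝ) (y : Rmn m n) : ℝ :=
  ∏ i, ((1 : ℝ) + ‖proj y i‖ ^ 2) ^ (s i / 2)

theorem sobW_eq (s : Fin m → ℝ) (f : Rmn m n → ℂ) :
    sobW s f = eLpNorm (fun y : Rmn m n => prodWeight s y * ‖𝓕 f y‖) 2 volume := rfl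

theorem proj_add (x y : Rmn m n) (i : Fin m) : proj (x + y) i = proj x i + proj y i := by
  ext j; simp [proj]

theorem proj_smul (c : ℝ) (x : Rmn m n) (i : Fin m) : proj (c • x) i = c • proj x i := by
  ext j; simp [proj]

theorem proj_neg (x : Rmn m n) (i : Fin m) : proj (-x) i = -proj x i := by
  ext j; simp [proj]

theorem norm_proj_le (x : Rmn m n) (i : Fin m) : ‖proj x i‖ ≤ ‖x‖ := by
  rw [EuclideanSpace.norm_eq, EuclideanSpace.norm_eq]
  apply Real.sqrt_le_sqrt
  rw [Fintype.sum_prod_type]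
  exact Finset.single_le_sum (f := fun i => ∑ j, ‖x (i, j)‖ ^ 2)
    (fun i _ => Finset.sum_nonneg fun j _ => by positivity) (Finset.mem_univ i)

theorem continuous_proj (i : Fin m) : Continuous fun x : Rmn m n => proj x i := by
  unfold proj
  fun_prop

theorem prodWeight_pos (s : Fin m → ℝ) (y : Rmn m n) : 0 < prodWeight s y :=
  Finset.prod_pos fun i _ => by positivity

theorem continuous_prodWeight (s : Fin m → ℝ) :
    Continuous (prodWeight s : Rmn m n → ℝ) := by
  refine continuous_finsetProd _ fun i _ => ?_
  refine Continuous.rpow_const ?_ fun x => Or.inl (by positivity)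
  have := continuous_proj (n := n) i
  fun_prop

theorem prodWeight_neg (s : Fin m → ℝ) (y : Rmn m n) : prodWeight s (-y) = prodWeight s y := by
  simp [prodWeight, proj_neg]

/-- Peetre's inequality for the product weight. -/
theorem prodWeight_add_le {s : Fin m → ℝ} (hs : ∀ i, 0 ≤ s i) (x y : Rmn m n) :
    prodWeight s (x + y) ≤ (∏ i, (2 : ℝ) ^ (s i / 2)) * (prodWeight s x * prodWeight s y) := by
  unfold prodWeight
  rw [← Finset.prod_mul_distrib, ← Finset.prod_mul_distrib]
  refine Finset.prod_le_prod (fun i _ => by positivity) fun i _ => ?_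
  rw [← Real.mul_rpow (by positivity) (by positivity),
    ← Real.mul_rpow (by positivity) (by positivity), proj_add]
  refine Real.rpow_le_rpow (by positivity) ?_ (by linarith [hs i])
  have h1 := norm_add_le (proj x i) (proj y i)
  have h2 : ‖proj x i + proj y i‖ ^ 2 ≤ (‖proj x i‖ + ‖proj y i‖) ^ 2 := by gcongr
  nlinarith [sq_nonneg (‖proj x i‖ - ‖proj y i‖),
    mul_nonneg (sq_nonneg ‖proj x i‖) (sq_nonneg ‖proj y i‖)]

theorem prodWeight_le_one_add_norm_rpow {s : Fin m → ℝ} (hs : ∀ i, 0 ≤ s i) (y : Rmn m n) :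
    prodWeight s y ≤ (1 + ‖y‖) ^ (∑ i, s i) := by
  rw [Real.rpow_sum_of_pos (by positivity)]
  refine Finset.prod_le_prod (fun i _ => by positivity) fun i _ => ?_
  have h1 := norm_proj_le y i
  have h3 : (1 : ℝ) + ‖proj y i‖ ^ 2 ≤ (1 + ‖y‖) ^ (2 : ℝ) := by
    rw [Real.rpow_two]
    have h2 : ‖proj y i‖ ^ 2 ≤ ‖y‖ ^ 2 := by gcongr
    nlinarith [norm_nonneg y]
  calc ((1 : ℝ) + ‖proj y i‖ ^ 2) ^ (s i / 2) ≤ ((1 + ‖y‖) ^ (2 : ℝ)) ^ (s i / 2) :=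
        Real.rpow_le_rpow (by positivity) h3 (by linarith [hs i])
    _ = (1 + ‖y‖) ^ (s i) := by
        rw [← Real.rpow_mul (by positivity)]; congr 1; ring

theorem prodWeight_smul_le {s : Fin m → ℝ} (hs : ∀ i, 0 ≤ s i) (c : ℝ) (y : Rmn m n) :
    prodWeight s (c • y) ≤ (∏ i, (1 + c ^ 2) ^ (s i / 2)) * prodWeight s y := by
  unfold prodWeight
  rw [← Finset.prod_mul_distrib]
  refine Finset.prod_le_prod (fun i _ => by positivity) fun i _ => ?_
  rw [← Real.mul_rpow (by positivity) (by positivity), proj_smul]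
  refine Real.rpow_le_rpow (by positivity) ?_ (by linarith [hs i])
  rw [norm_smul, mul_pow, Real.norm_eq_abs, sq_abs]
  nlinarith [sq_nonneg c, sq_nonneg ‖proj y i‖]

theorem fourier_comp_smul {c : ℝ} (hc : c ≠ 0) (f : Rmn m n → ℂ) (y : Rmn m n) :
    𝓕 (fun ξ => f (c • ξ)) y =
      |(c ^ Module.finrank ℝ (Rmn m n))⁻¹| • 𝓕 f (c⁻¹ • y) := by
  rw [Real.fourier_eq, Real.fourier_eq,
    ← Measure.integral_comp_smul volume (fun v => 𝐞 (-⟪v, c⁻¹ • y⟫) • f v) c]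
  refine integral_congr_ae (Filter.Eventually.of_forall fun v => ?_)
  simp only [inner_smul_left, inner_smul_right, conj_trivial]
  rw [← mul_assoc, inv_mul_cancel₀ hc, one_mul]

theorem eLpNorm_comp_smul {c : ℝ} (hc : c ≠ 0) (G : Rmn m n → ℝ) :
    eLpNorm (fun y => G (c • y)) 2 volume =
      ENNReal.ofReal |(c ^ Module.finrank ℝ (Rmn m n))⁻¹| ^ (1 / 2 : ℝ) *
        eLpNorm G 2 volume := by
  have he : MeasurableEmbedding fun y : Rmn m n => c • y :=
    (Homeomorph.smulOfNeZero c hc).measurableEmbedding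
  have h := he.eLpNorm_map_measure (g := G) (p := 2) (μ := volume)
  rw [Measure.map_addHaar_smul volume hc, eLpNorm_smul_measure_of_ne_top (by simp)] at h
  simpa [Function.comp_def] using h.symm

/-- Dilations are bounded in the product-type Sobolev norm. -/
theorem exists_sobW_comp_smul_le {s : Fin m → ℝ} (hs : ∀ i, 0 ≤ s i) {c : ℝ} (hc : c ≠ 0) :
    ∃ K : ℝ≥0, ∀ f : Rmn m n → ℂ, sobW s (fun ξ => f (c • ξ)) ≤ K * sobW s f := by
  set a : ℝ := |(c ^ Module.finrank ℝ (Rmn m n))⁻¹| with ha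
  set D : ℝ := ∏ i, (1 + c ^ 2) ^ (s i / 2) with hD
  have hD0 : 0 ≤ D := Finset.prod_nonneg fun i _ => by positivity
  set b : ℝ≥0∞ := ENNReal.ofReal |((c⁻¹) ^ Module.finrank ℝ (Rmn m n))⁻¹| ^ (1 / 2 : ℝ) with hb
  have hb_top : b ≠ ∞ := by simp [hb]
  refine ⟨(a * D).toNNReal * b.toNNReal, fun f => ?_⟩
  rw [sobW_eq, sobW_eq]
  have key : ∀ y : Rmn m n, ‖prodWeight s y * ‖𝓕 (fun ξ => f (c • ξ)) y‖‖ ≤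
      (a * D) * ‖(fun y => prodWeight s (c⁻¹ • y) * ‖𝓕 f (c⁻¹ • y)‖) y‖ := by
    intro y
    have h1 := prodWeight_smul_le hs c (c⁻¹ • y)
    rw [smul_inv_smul₀ hc] at h1
    have h2 := (prodWeight_pos s y).le
    have h3 := (prodWeight_pos s (c⁻¹ • y)).le
    rw [Real.norm_of_nonneg (by positivity), Real.norm_of_nonneg (by positivity),
      fourier_comp_smul hc, norm_smul, Real.norm_of_nonneg (by positivity)]
    calc prodWeight s y * (a * ‖𝓕 f (c⁻¹ • y)‖)
        ≤ (D * prodWeight s (c⁻¹ • y)) * (a * ‖𝓕 f (c⁻¹ • y)‖) := by gcongr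
      _ = _ := by ring
  refine (eLpNorm_le_mul_eLpNorm_of_ae_le_mul (Filter.Eventually.of_forall key) 2).trans ?_
  rw [eLpNorm_comp_smul (inv_ne_zero hc) fun y => prodWeight s y * ‖𝓕 f y‖, ← hb, ← mul_assoc,
    ENNReal.coe_mul, ENNReal.coe_toNNReal hb_top]
  rfl

/-- Young's inequality `L¹ * L² → L²`, for a pointwise majorant of convolution type. -/
theorem eLpNorm_two_le_of_enorm_le_lintegral {E : Type*} [NormedAddCommGroup E]
    [MeasurableSpace E] [BorelSpace E] [SecondCountableTopology E] {μ : Measure E} [SFinite μ]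
    [μ.IsAddRightInvariant] {F G : E → ℝ} {a : E → ℝ≥0∞} (ha : Measurable a) (hG : Measurable G)
    (h : ∀ y, ‖F y‖ₑ ≤ ∫⁻ w, a w * ‖G (y + w)‖ₑ ∂μ) :
    eLpNorm F 2 μ ≤ (∫⁻ w, a w ∂μ) * eLpNorm G 2 μ := by
  have cs : ∀ y, ‖F y‖ₑ ^ (2 : ℝ) ≤ (∫⁻ w, a w ∂μ) * ∫⁻ w, a w * ‖G (y + w)‖ₑ ^ (2 : ℝ) ∂μ := by
    intro y
    have h1 := ENNReal.lintegral_mul_le_Lp_mul_Lq μ Real.HolderConjugate.two_two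
      (f := fun w => a w ^ (1 / 2 : ℝ)) (g := fun w => a w ^ (1 / 2 : ℝ) * ‖G (y + w)‖ₑ)
      (by fun_prop) (by fun_prop)
    have e1 : ∀ w, ((fun w => a w ^ (1 / 2 : ℝ)) * fun w => a w ^ (1 / 2 : ℝ) * ‖G (y + w)‖ₑ) w
        = a w * ‖G (y + w)‖ₑ := fun w => by
      simp only [Pi.mul_apply]
      rw [← mul_assoc, ← ENNReal.rpow_add_of_nonneg _ _ (by norm_num) (by norm_num)]
      norm_num
    have e2 : ∀ w, (a w ^ (1 / 2 : ℝ)) ^ (2 : ℝ) = a w := fun w => by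
      rw [← ENNReal.rpow_mul]; norm_num
    simp_rw [e1, ENNReal.mul_rpow_of_nonneg _ _ (zero_le_two (α := ℝ)), e2] at h1
    calc ‖F y‖ₑ ^ (2 : ℝ) ≤ (((∫⁻ w, a w ∂μ) ^ (1 / 2 : ℝ)) *
          (∫⁻ w, a w * ‖G (y + w)‖ₑ ^ (2 : ℝ) ∂μ) ^ (1 / 2 : ℝ)) ^ (2 : ℝ) := by
            gcongr
            exact (h y).trans h1
      _ = _ := by
        rw [ENNReal.mul_rpow_of_nonneg _ _ zero_le_two, ← ENNReal.rpow_mul, ← ENNReal.rpow_mul]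
        norm_num
  rw [eLpNorm_eq_lintegral_rpow_enorm_toReal (by simp) (by simp),
    eLpNorm_eq_lintegral_rpow_enorm_toReal (by simp) (by simp), ENNReal.toReal_ofNat]
  have main : ∫⁻ y, ‖F y‖ₑ ^ (2 : ℝ) ∂μ ≤
      (∫⁻ w, a w ∂μ) ^ (2 : ℝ) * ∫⁻ y, ‖G y‖ₑ ^ (2 : ℝ) ∂μ := by
    calc ∫⁻ y, ‖F y‖ₑ ^ (2 : ℝ) ∂μ
        ≤ ∫⁻ y, (∫⁻ w, a w ∂μ) * ∫⁻ w, a w * ‖G (y + w)‖ₑ ^ (2 : ℝ) ∂μ ∂μ := lintegral_mono cs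
      _ = (∫⁻ w, a w ∂μ) * ∫⁻ y, ∫⁻ w, a w * ‖G (y + w)‖ₑ ^ (2 : ℝ) ∂μ ∂μ := by
          rw [lintegral_const_mul]
          exact Measurable.lintegral_prod_right'
            (f := fun p : E × E => a p.2 * ‖G (p.1 + p.2)‖ₑ ^ (2 : ℝ)) (by fun_prop)
      _ = (∫⁻ w, a w ∂μ) * ∫⁻ w, ∫⁻ y, a w * ‖G (y + w)‖ₑ ^ (2 : ℝ) ∂μ ∂μ := by
          rw [lintegral_lintegral_swap]
          exact Measurable.aemeasurable (by fun_prop)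
      _ = (∫⁻ w, a w ∂μ) * ∫⁻ w, a w * ∫⁻ y, ‖G y‖ₑ ^ (2 : ℝ) ∂μ ∂μ := by
          congr 1
          refine lintegral_congr fun w => ?_
          rw [lintegral_const_mul _ (by fun_prop),
            lintegral_add_right_eq_self (fun y => ‖G y‖ₑ ^ (2 : ℝ)) w]
      _ = _ := by
          rw [lintegral_mul_const _ ha, ← mul_assoc, ENNReal.rpow_two, sq]
  calc _ ≤ ((∫⁻ w, a w ∂μ) ^ (2 : ℝ) * ∫⁻ y, ‖G y‖ₑ ^ (2 : ℝ) ∂μ) ^ (1 / 2 : ℝ) := by gcongr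
    _ = _ := by
      rw [ENNReal.mul_rpow_of_nonneg _ _ (by norm_num), ← ENNReal.rpow_mul]
      norm_num

theorem fourier_mul_eq_integral {g h : Rmn m n → ℂ} (hg : Integrable g) (hh : Continuous h)
    (hhi : Integrable h) (hhf : Integrable (𝓕 h)) (hhf' : Integrable (𝓕⁻ h)) (y : Rmn m n) :
    𝓕 (fun ξ => g ξ * h ξ) y = ∫ w, 𝓕⁻ h w * 𝓕 g (y + w) := by
  have hb : Integrable fun ξ : Rmn m n => 𝐞 (-⟪ξ, y⟫) • g ξ :=
    (Real.fourierIntegral_convergent_iff y).2 hg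
  have hflip : ∫ ξ, 𝓕 (𝓕⁻ h) ξ • (𝐞 (-⟪ξ, y⟫) • g ξ) =
      ∫ w, 𝓕⁻ h w • 𝓕 (fun ξ => 𝐞 (-⟪ξ, y⟫) • g ξ) w := by
    simpa using! VectorFourier.integral_fourierIntegral_smul_eq_flip (L := innerₗ (Rmn m n))
      Real.continuous_fourierChar continuous_inner hhf' hb
  rw [hh.fourier_fourierInv_eq hhi hhf] at hflip
  rw [Real.fourier_eq]
  refine Eq.trans (integral_congr_ae (Filter.Eventually.of_forall fun ξ => ?_)) (hflip.trans
    (integral_congr_ae (Filter.Eventually.of_forall fun w => ?_)))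
  · simp only [Circle.smul_def, smul_eq_mul]; ring
  · simp only [smul_eq_mul, Real.fourier_eq]
    congr 2
    ext v
    rw [smul_smul, ← AddChar.map_add_eq_mul, inner_add_right]
    congr 2
    ring

theorem measurable_fourier {g : Rmn m n → ℂ} (hg : Integrable g) : Measurable (𝓕 g) :=
  (VectorFourier.fourierIntegral_continuous Real.continuous_fourierChar
    (L := innerₗ (Rmn m n)) continuous_inner hg).measurable

theorem sobW_mul_le_lintegral {s : Fin m → ℝ} (hs : ∀ i, 0 ≤ s i) {g h : Rmn m n → ℂ}
    (hg : Integrable g) (hh : Continuous h) (hhi : Integrable h) (hhf : Integrable (𝓕 h))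
    (hhf' : Integrable (𝓕⁻ h)) :
    sobW s (fun ξ => g ξ * h ξ) ≤
      (∫⁻ w, ENNReal.ofReal ((∏ i, (2 : ℝ) ^ (s i / 2)) * (prodWeight s w * ‖𝓕⁻ h w‖))) *
        sobW s g := by
  set A : ℝ := ∏ i, (2 : ℝ) ^ (s i / 2) with hA
  have hA0 : 0 ≤ A := Finset.prod_nonneg fun i _ => by positivity
  rw [sobW_eq, sobW_eq]
  have hW := (continuous_prodWeight (n := n) s).measurable
  have hm : Measurable (𝓕⁻ h) := by
    have : 𝓕⁻ h = fun w => 𝓕 h (-w) := funext fun w => Real.fourierInv_eq_fourier_neg h w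
    rw [this]
    exact (measurable_fourier hhi).comp measurable_neg
  have hmg := measurable_fourier hg
  refine eLpNorm_two_le_of_enorm_le_lintegral (by fun_prop) (by fun_prop) fun y => ?_
  rw [enorm_mul, enorm_norm, fourier_mul_eq_integral hg hh hhi hhf hhf']
  calc ‖prodWeight s y‖ₑ * ‖∫ w, 𝓕⁻ h w * 𝓕 g (y + w)‖ₑ
      ≤ ‖prodWeight s y‖ₑ * ∫⁻ w, ‖𝓕⁻ h w * 𝓕 g (y + w)‖ₑ := by
        gcongr
        exact enorm_integral_le_lintegral_enorm _
    _ = ∫⁻ w, ‖prodWeight s y‖ₑ * ‖𝓕⁻ h w * 𝓕 g (y + w)‖ₑ :=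
        (lintegral_const_mul _ (by fun_prop)).symm
    _ ≤ _ := lintegral_mono fun w => ?_
  simp only
  have h1 : prodWeight s y ≤ A * (prodWeight s (y + w) * prodWeight s w) := by
    have := prodWeight_add_le hs (y + w) (-w)
    rwa [add_neg_cancel_right, prodWeight_neg] at this
  have p1 := (prodWeight_pos s y).le
  have p2 := (prodWeight_pos s w).le
  have p3 := (prodWeight_pos s (y + w)).le
  simp only [← ofReal_norm]
  rw [← ENNReal.ofReal_mul (by positivity), ← ENNReal.ofReal_mul (by positivity)]
  refine ENNReal.ofReal_le_ofReal ?_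
  rw [norm_mul, norm_mul, norm_norm, Real.norm_of_nonneg p1, Real.norm_of_nonneg p3]
  calc prodWeight s y * (‖𝓕⁻ h w‖ * ‖𝓕 g (y + w)‖)
      ≤ (A * (prodWeight s (y + w) * prodWeight s w)) * (‖𝓕⁻ h w‖ * ‖𝓕 g (y + w)‖) := by gcongr
    _ = _ := by ring

theorem pow_mul_norm_fourier_le {h : Rmn m n → ℂ} {R : ℝ} {B : ℕ → ℝ}
    (hh : ContDiff ℝ (⊤ : ℕ∞) h) (hR : tsupport h ⊆ closedBall 0 R)
    (hB : ∀ l ξ, ‖iteratedFDeriv ℝ l h ξ‖ ≤ B l) (N : ℕ) (w : Rmn m n) :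
    ‖w‖ ^ N * ‖𝓕 h w‖ ≤ 2 ^ N *
      ∑ l ∈ Finset.range (N + 1), B l * volume.real (closedBall (0 : Rmn m n) R) := by
  have hc : HasCompactSupport h := (isCompact_closedBall 0 R).of_isClosed_subset
    (isClosed_tsupport h) hR
  have hint : ∀ l : ℕ, Integrable fun v => ‖iteratedFDeriv ℝ l h v‖ := fun l =>
    ((hh.continuous_iteratedFDeriv (mod_cast le_top)).integrable_of_hasCompactSupport
      (hc.iteratedFDeriv l)).norm
  have h1 := Real.pow_mul_norm_iteratedFDeriv_fourier_le (K := 0) (N := ⊤) (k := 0) (n := N) hh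
    (fun k l hk _ => by
      obtain rfl : k = 0 := by simpa using hk
      simpa using hint l) le_rfl le_top w
  simp only [norm_iteratedFDeriv_zero, pow_zero, one_mul, Nat.cast_zero, mul_zero, zero_add,
    Finset.range_one, Finset.sum_product, Finset.sum_singleton] at h1
  refine h1.trans ?_
  gcongr with l _
  calc ∫ v, ‖iteratedFDeriv ℝ l h v‖
      = ∫ v in closedBall (0 : Rmn m n) R, ‖iteratedFDeriv ℝ l h v‖ := by
        refine (setIntegral_eq_integral_of_forall_compl_eq_zero fun v hv => ?_).symm
        rw [norm_eq_zero]
        by_contra hne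
        exact hv (hR (support_iteratedFDeriv_subset l hne))
    _ ≤ ∫ v in closedBall (0 : Rmn m n) R, B l := by
        refine setIntegral_mono (hint l).integrableOn ?_ (fun v => hB l v)
        exact integrableOn_const (by exact (isCompact_closedBall _ _).measure_lt_top.ne)
    _ = _ := by rw [setIntegral_const, smul_eq_mul, mul_comm]

/-- Multiplication by smooth functions with a common compact support and common derivative bounds
is uniformly bounded in the product-type Sobolev norm. -/
theorem exists_sobW_mul_le {s : Fin m → ℝ} (hs : ∀ i, 0 ≤ s i) (R : ℝ) (B : ℕ → ℝ) :
    ∃ K : ℝ≥0, ∀ h : Rmn m n → ℂ, ContDiff ℝ (⊤ : ℕ∞) h → tsupport h ⊆ closedBall 0 R →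
      (∀ l ξ, ‖iteratedFDeriv ℝ l h ξ‖ ≤ B l) →
      ∀ g : Rmn m n → ℂ, Integrable g → sobW s (fun ξ => g ξ * h ξ) ≤ K * sobW s g := by
  set A : ℝ := ∏ i, (2 : ℝ) ^ (s i / 2) with hA
  have hA0 : 0 ≤ A := Finset.prod_nonneg fun i _ => by positivity
  set S : ℝ := ∑ i, s i with hS
  obtain ⟨N, hN⟩ := exists_nat_gt (S + Module.finrank ℝ (Rmn m n))
  let M : ℕ → ℝ := fun N => 2 ^ N *
    ∑ l ∈ Finset.range (N + 1), B l * volume.real (closedBall (0 : Rmn m n) R)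
  set L : ℝ := 2 ^ N * (M 0 + M N) with hL
  have hfin : ∫⁻ w : Rmn m n, ENNReal.ofReal ((1 + ‖w‖) ^ (-((N : ℝ) - S))) < ∞ :=
    finite_integral_one_add_norm (by linarith)
  refine ⟨(ENNReal.ofReal (A * L) *
    ∫⁻ w : Rmn m n, ENNReal.ofReal ((1 + ‖w‖) ^ (-((N : ℝ) - S)))).toNNReal,
    fun h hh hR hB g hg => ?_⟩
  rw [ENNReal.coe_toNNReal (ENNReal.mul_lt_top ENNReal.ofReal_lt_top hfin).ne]
  have hc : HasCompactSupport h := (isCompact_closedBall 0 R).of_isClosed_subset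
    (isClosed_tsupport h) hR
  let φ : 𝓢(Rmn m n, ℂ) := hc.toSchwartzMap hh
  have hcoe : (φ : Rmn m n → ℂ) = h := rfl
  have hhi : Integrable h := hh.continuous.integrable_of_hasCompactSupport hc
  have hhf : Integrable (𝓕 h) := by
    rw [← hcoe, ← SchwartzMap.fourier_coe]; exact (𝓕 φ).integrable
  have hhf' : Integrable (𝓕⁻ h) := by
    rw [← hcoe, ← SchwartzMap.fourierInv_coe]; exact (𝓕⁻ φ).integrable
  refine (sobW_mul_le_lintegral hs hg hh.continuous hhi hhf hhf').trans ?_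
  gcongr
  rw [← lintegral_const_mul' _ _ ENNReal.ofReal_ne_top]
  refine lintegral_mono fun w => ?_
  simp only
  rw [← ENNReal.ofReal_mul' (by positivity)]
  refine ENNReal.ofReal_le_ofReal ?_
  rw [← hA, mul_assoc]
  refine mul_le_mul_of_nonneg_left ?_ hA0
  rw [Real.fourierInv_eq_fourier_neg]
  have h0 := pow_mul_norm_fourier_le hh hR hB 0 (-w)
  have h1 := pow_mul_norm_fourier_le hh hR hB N (-w)
  rw [norm_neg] at h0 h1
  have hdecay : (1 + ‖w‖) ^ N * ‖𝓕 h (-w)‖ ≤ L := by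
    have h2 : (1 + ‖w‖) ^ N ≤ 2 ^ N * (1 + ‖w‖ ^ N) := by
      refine (add_pow_le zero_le_one (norm_nonneg w) N).trans ?_
      rw [one_pow]
      gcongr
      · norm_num
      · omega
    calc (1 + ‖w‖) ^ N * ‖𝓕 h (-w)‖ ≤ (2 ^ N * (1 + ‖w‖ ^ N)) * ‖𝓕 h (-w)‖ := by gcongr
      _ = 2 ^ N * (‖w‖ ^ 0 * ‖𝓕 h (-w)‖ + ‖w‖ ^ N * ‖𝓕 h (-w)‖) := by ring
      _ ≤ L := by rw [hL]; gcongr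
  have hw : (0 : ℝ) < 1 + ‖w‖ := by positivity
  calc prodWeight s w * ‖𝓕 h (-w)‖ ≤ (1 + ‖w‖) ^ S * ‖𝓕 h (-w)‖ := by
        gcongr; exact prodWeight_le_one_add_norm_rpow hs w
    _ = ((1 + ‖w‖) ^ N * ‖𝓕 h (-w)‖) * (1 + ‖w‖) ^ (-((N : ℝ) - S)) := by
        rw [neg_sub, Real.rpow_sub hw, Real.rpow_natCast]
        field_simp
    _ ≤ L * (1 + ‖w‖) ^ (-((N : ℝ) - S)) := by gcongr

theorem tsupport_subset_annulus {ζhat : Rmn m n → ℂ} {r₁ r₂ : ℝ}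
    (hζ : ∀ ξ, ζhat ξ ≠ 0 → r₁ ≤ ‖ξ‖ ∧ ‖ξ‖ ≤ r₂) {ξ : Rmn m n} (hξ : ξ ∈ tsupport ζhat) :
    r₁ ≤ ‖ξ‖ ∧ ‖ξ‖ ≤ r₂ := by
  have hcl : IsClosed {ξ : Rmn m n | r₁ ≤ ‖ξ‖ ∧ ‖ξ‖ ≤ r₂} :=
    (isClosed_le continuous_const continuous_norm).inter
      (isClosed_le continuous_norm continuous_const)
  exact closure_minimal (fun ξ h => hζ ξ h) hcl hξ

theorem contDiffOn_dilate {Φ : Rmn m n → ℂ} (hΦ : ContDiffOn ℝ (⊤ : ℕ∞) Φ {(0 : Rmn m n)}ᶜ)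
    {t : ℝ} (ht : t ≠ 0) :
    ContDiffOn ℝ (⊤ : ℕ∞) (fun ξ => Φ (t • ξ)) {(0 : Rmn m n)}ᶜ :=
  hΦ.comp (contDiff_const_smul t).contDiffOn fun ξ hξ => by
    simpa [ht] using hξ

/-- The Mikhlin condition is invariant under dilations. -/
theorem norm_iteratedFDerivWithin_dilate_le {Φ : Rmn m n → ℂ} {k : ℕ} {C : ℝ}
    (hΦ : ∀ ξ : Rmn m n, ξ ≠ 0 → ‖iteratedFDeriv ℝ k Φ ξ‖ ≤ C * ‖ξ‖ ^ (-(k : ℝ)))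
    {t : ℝ} (ht : 0 < t) {ξ : Rmn m n} (hξ : ξ ≠ 0) :
    ‖iteratedFDerivWithin ℝ k (fun ξ => Φ (t • ξ)) {(0 : Rmn m n)}ᶜ ξ‖ ≤
      C * ‖ξ‖ ^ (-(k : ℝ)) := by
  let g : Rmn m n ≃L[ℝ] Rmn m n := ContinuousLinearEquiv.smulLeft (Units.mk0 t ht.ne')
  have hg : ∀ x, g x = t • x := fun x => rfl
  have hpre : g ⁻¹' {(0 : Rmn m n)}ᶜ = {(0 : Rmn m n)}ᶜ := by
    ext x; simp
  have hmem : g ξ ∈ ({(0 : Rmn m n)}ᶜ : Set (Rmn m n)) := by simpa using hξ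
  have h1 := g.iteratedFDerivWithin_comp_right Φ isOpen_compl_singleton.uniqueDiffOn hmem k
  rw [hpre, iteratedFDerivWithin_of_isOpen k isOpen_compl_singleton hmem] at h1
  have hnorm : ‖(g : Rmn m n →L[ℝ] Rmn m n)‖ ≤ t :=
    ContinuousLinearMap.opNorm_le_bound _ ht.le fun x => by
      simp [hg, norm_smul, abs_of_pos ht]
  have hξ' : 0 < ‖ξ‖ := norm_pos_iff.2 hξ
  calc ‖iteratedFDerivWithin ℝ k (Φ ∘ g) {(0 : Rmn m n)}ᶜ ξ‖
      ≤ ‖iteratedFDeriv ℝ k Φ (g ξ)‖ * ∏ _i : Fin k, ‖(g : Rmn m n →L[ℝ] Rmn m n)‖ := by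
        rw [h1]
        exact ContinuousMultilinearMap.norm_compContinuousLinearMap_le _ _
    _ ≤ (C * ‖g ξ‖ ^ (-(k : ℝ))) * t ^ k := by
        have h2 := hΦ (g ξ) hmem
        have h3 : (0 : ℝ) ≤ C * ‖g ξ‖ ^ (-(k : ℝ)) := (norm_nonneg _).trans h2
        rw [Finset.prod_const, Finset.card_univ, Fintype.card_fin]
        gcongr
    _ = C * ‖ξ‖ ^ (-(k : ℝ)) := by
        rw [hg, norm_smul, Real.norm_of_nonneg ht.le, Real.mul_rpow ht.le hξ'.le,
          Real.rpow_neg ht.le, Real.rpow_natCast]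
        field_simp

theorem contDiff_dilate_mul {ζhat : Rmn m n → ℂ} (hζsmooth : ContDiff ℝ (⊤ : ℕ∞) ζhat)
    {r₁ r₂ : ℝ} (hr₁ : 0 < r₁) (hζ : ∀ ξ, ζhat ξ ≠ 0 → r₁ ≤ ‖ξ‖ ∧ ‖ξ‖ ≤ r₂)
    {Φ : Rmn m n → ℂ} (hΦsmooth : ContDiffOn ℝ (⊤ : ℕ∞) Φ {(0 : Rmn m n)}ᶜ)
    {t : ℝ} (ht : t ≠ 0) :
    ContDiff ℝ (⊤ : ℕ∞) fun ξ => Φ (t • ξ) * ζhat ξ := by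
  rw [contDiff_iff_contDiffAt]
  intro ξ
  by_cases hξ : ξ ∈ tsupport ζhat
  · have h0 : ξ ≠ 0 := norm_pos_iff.1 (hr₁.trans_le (tsupport_subset_annulus hζ hξ).1)
    exact ((contDiffOn_dilate hΦsmooth ht).contDiffAt
      (isOpen_compl_singleton.mem_nhds h0)).mul hζsmooth.contDiffAt
  · refine (contDiffAt_const (c := (0 : ℂ))).congr_of_eventuallyEq ?_
    filter_upwards [notMem_tsupport_iff_eventuallyEq.1 hξ] with x hx
    simp [hx]

theorem exists_iteratedFDeriv_dilate_mul_le {ζhat : Rmn m n → ℂ}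
    (hζsmooth : ContDiff ℝ (⊤ : ℕ∞) ζhat)
    {r₁ r₂ : ℝ} (hr₁ : 0 < r₁) (hζ : ∀ ξ, ζhat ξ ≠ 0 → r₁ ≤ ‖ξ‖ ∧ ‖ξ‖ ≤ r₂)
    {Φ : Rmn m n → ℂ} (hΦsmooth : ContDiffOn ℝ (⊤ : ℕ∞) Φ {(0 : Rmn m n)}ᶜ)
    (hΦ : ∀ k : ℕ, ∃ Ck : ℝ, ∀ ξ : Rmn m n, ξ ≠ 0 →
      ‖iteratedFDeriv ℝ k Φ ξ‖ ≤ Ck * ‖ξ‖ ^ (-(k : ℝ))) :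
    ∃ B : ℕ → ℝ, ∀ t : ℝ, 0 < t → ∀ l ξ,
      ‖iteratedFDeriv ℝ l (fun ξ => Φ (t • ξ) * ζhat ξ) ξ‖ ≤ B l := by
  choose C hC using hΦ
  have hcs : HasCompactSupport ζhat := (isCompact_closedBall 0 r₂).of_isClosed_subset
    (isClosed_tsupport _) fun ξ hξ => by simpa using (tsupport_subset_annulus hζ hξ).2
  have hZ : ∀ k : ℕ, ∃ Z : ℝ, ∀ ξ, ‖iteratedFDeriv ℝ k ζhat ξ‖ ≤ Z := fun k =>
    (hcs.iteratedFDeriv k).exists_bound_of_continuous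
      (hζsmooth.continuous_iteratedFDeriv (mod_cast le_top))
  choose Z hZ using hZ
  have hZ0 : ∀ k, 0 ≤ Z k := fun k => (norm_nonneg _).trans (hZ k 0)
  refine ⟨fun l => ∑ i ∈ Finset.range (l + 1),
    (l.choose i : ℝ) * (|C i| * r₁ ^ (-(i : ℝ))) * Z (l - i), fun t ht l ξ => ?_⟩
  by_cases hξ : ξ ∈ tsupport ζhat
  · have hr := (tsupport_subset_annulus hζ hξ).1
    have h0 : ξ ≠ 0 := norm_pos_iff.1 (hr₁.trans_le hr)
    have hopen : IsOpen ({(0 : Rmn m n)}ᶜ : Set (Rmn m n)) := isOpen_compl_singleton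
    rw [← iteratedFDerivWithin_of_isOpen l hopen h0]
    refine (norm_iteratedFDerivWithin_mul_le (contDiffOn_dilate hΦsmooth ht.ne')
      hζsmooth.contDiffOn hopen.uniqueDiffOn h0 (n := l) (mod_cast le_top)).trans ?_
    refine Finset.sum_le_sum fun i _ => ?_
    have h1 : ‖iteratedFDerivWithin ℝ i (fun ξ => Φ (t • ξ)) {(0 : Rmn m n)}ᶜ ξ‖ ≤
        |C i| * r₁ ^ (-(i : ℝ)) := by
      refine (norm_iteratedFDerivWithin_dilate_le (hC i) ht h0).trans ?_
      refine mul_le_mul (le_abs_self _) ?_ (by positivity) (abs_nonneg _)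
      exact Real.rpow_le_rpow_of_nonpos hr₁ hr (by simp)
    have h2 : ‖iteratedFDerivWithin ℝ (l - i) ζhat {(0 : Rmn m n)}ᶜ ξ‖ ≤ Z (l - i) := by
      rw [iteratedFDerivWithin_of_isOpen _ hopen h0]
      exact hZ _ _
    gcongr
  · have hz : iteratedFDeriv ℝ l (fun ξ => Φ (t • ξ) * ζhat ξ) ξ = 0 := by
      by_contra hne
      exact hξ (tsupport_mul_subset_right (support_iteratedFDeriv_subset l hne))
    rw [hz, norm_zero]
    exact Finset.sum_nonneg fun i _ => by have := hZ0 (l - i); positivity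

theorem sobW_sum_le {ι : Type*} (s : Fin m → ℝ) (I : Finset ι) {f : ι → Rmn m n → ℂ}
    (hf : ∀ i ∈ I, Integrable (f i)) :
    sobW s (fun ξ => ∑ i ∈ I, f i ξ) ≤ ∑ i ∈ I, sobW s (f i) := by
  simp only [sobW_eq]
  have hW := (continuous_prodWeight (n := n) s).measurable
  refine le_trans ?_ (eLpNorm_sum_le (fun i hi => Measurable.aestronglyMeasurable ?_) one_le_two)
  · refine eLpNorm_mono fun y => ?_
    have hF : 𝓕 (fun ξ => ∑ i ∈ I, f i ξ) y = ∑ i ∈ I, 𝓕 (f i) y := by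
      simp only [Real.fourier_eq, Finset.smul_sum]
      exact integral_finsetSum _ fun i hi => (Real.fourierIntegral_convergent_iff y).2 (hf i hi)
    have hp := (prodWeight_pos s y).le
    rw [hF, Finset.sum_apply, ← Finset.mul_sum, norm_mul, norm_mul, norm_norm]
    gcongr
    exact (norm_sum_le _ _).trans (le_abs_self _)
  · have := measurable_fourier (hf i hi)
    fun_prop

/-- On an annulus, the Littlewood–Paley decomposition is a finite sum. -/
theorem IsLP.exists_sum_eq_one {ψ : 𝓢(Rmn m n, ℂ)} (hψ : IsLP m n ψ) {r₁ r₂ : ℝ} (hr₁ : 0 < r₁) :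
    ∃ I : Finset ℤ, ∀ ξ : Rmn m n, r₁ ≤ ‖ξ‖ → ‖ξ‖ ≤ r₂ →
      ∑ k ∈ I, 𝓕 (⇑ψ) ((2 : ℝ) ^ (-k) • ξ) = 1 := by
  obtain ⟨N, hN⟩ := pow_unbounded_of_one_lt (max (2 * r₂) (2 / r₁)) (one_lt_two (α := ℝ))
  obtain ⟨hN2, hN1⟩ := max_lt_iff.1 hN
  refine ⟨Finset.Icc (-N) N, fun ξ h1 h2 => ?_⟩
  have hξ : 0 < ‖ξ‖ := hr₁.trans_le h1
  refine (hasSum_sum_of_ne_finset_zero fun k hk => ?_).unique (hψ.2 ξ (norm_pos_iff.1 hξ))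
  by_contra hne
  obtain ⟨h3, h4⟩ := hψ.1 _ hne
  have h2k : (0 : ℝ) < 2 ^ k := by positivity
  rw [norm_smul, Real.norm_of_nonneg (by positivity), zpow_neg] at h3 h4
  rw [inv_mul_le_iff₀ h2k] at h4
  rw [le_inv_mul_iff₀ h2k] at h3
  refine hk (Finset.mem_Icc.2 ⟨?_, ?_⟩)
  · have : (2 : ℝ) ^ (-(N : ℤ)) < 2 ^ k := by
      rw [zpow_neg, zpow_natCast, inv_lt_iff_one_lt_mul₀ (by positivity)]
      rw [div_lt_iff₀ hr₁] at hN1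
      nlinarith
    exact ((zpow_lt_zpow_iff_right₀ one_lt_two).1 this).le
  · have : (2 : ℝ) ^ k < 2 ^ (N : ℤ) := by
      rw [zpow_natCast]
      linarith
    exact ((zpow_lt_zpow_iff_right₀ one_lt_two).1 this).le

theorem integrable_dilate_mul_fourier (ψ : 𝓢(Rmn m n, ℂ)) {σ : Rmn m n → ℂ} (hσ : Measurable σ)
    (hb : Bdd σ) (t : ℝ) {c : ℝ} (hc : c ≠ 0) :
    Integrable fun ξ => σ (t • ξ) * 𝓕 (⇑ψ) (c • ξ) := by
  obtain ⟨M, hM⟩ := hb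
  have hi : Integrable (𝓕 (⇑ψ)) := by
    rw [← SchwartzMap.fourier_coe]; exact (𝓕 ψ).integrable
  exact (hi.comp_smul hc).bdd_mul (c := M) (hσ.comp (measurable_const_smul t)).aestronglyMeasurable
    (Filter.Eventually.of_forall fun ξ => hM _)

end MLFM

/-- Lemma 2.3: replacing the Littlewood–Paley cutoff `ψ̂` by `Φ(2^j·)ζ̂`,
where `ζ̂` is smooth and supported in an annulus and `Φ` satisfies Mikhlin-type estimates,
does not increase the `sup_j` of the product-type Sobolev norms (up to a constant). -/
theorem sobolev_bound_cutoff_change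
    (m n : ℕ) (hm : 0 < m) (hn : 0 < n)
    (s : Fin m → ℝ) (hs : ∀ i, (n : ℝ) / 2 < s i)
    (ψ : 𝓢(Rmn m n, ℂ)) (hψ : IsLP m n ψ)
    (ζhat : Rmn m n → ℂ) (hζsmooth : ContDiff ℝ (⊤ : ℕ∞) ζhat)
    (hζsupp : ∃ r₁ r₂ : ℝ, 0 < r₁ ∧ ∀ ξ, ζhat ξ ≠ 0 → r₁ ≤ ‖ξ‖ ∧ ‖ξ‖ ≤ r₂)
    (Φ : Rmn m n → ℂ) (hΦsmooth : ContDiffOn ℝ (⊤ : ℕ∞) Φ {(0 : Rmn m n)}ᶜ)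
    (hΦ : ∀ k : ℕ, ∃ Ck : ℝ, ∀ ξ : Rmn m n, ξ ≠ 0 →
      ‖iteratedFDeriv ℝ k Φ ξ‖ ≤ Ck * ‖ξ‖ ^ (-(k : ℝ))) :
    ∃ C : ℝ≥0, ∀ σ : Rmn m n → ℂ, Measurable σ → Bdd σ →
      (⨆ j : ℤ, sobW s fun ξ => σ ((2:ℝ) ^ j • ξ) * Φ ((2:ℝ) ^ j • ξ) * ζhat ξ) ≤
        C * mulBound s ψ σ := by
  obtain ⟨r₁, r₂, hr₁, hζ⟩ := hζsupp
  have hs0 : ∀ i, 0 ≤ s i := fun i => (div_nonneg n.cast_nonneg zero_le_two).trans (hs i).le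
  obtain ⟨B, hB⟩ := exists_iteratedFDeriv_dilate_mul_le hζsmooth hr₁ hζ hΦsmooth hΦ
  obtain ⟨K, hK⟩ := exists_sobW_mul_le (n := n) hs0 r₂ B
  obtain ⟨I, hI⟩ := hψ.exists_sum_eq_one (r₂ := r₂) hr₁
  have hpow : ∀ k : ℤ, (2 : ℝ) ^ k ≠ 0 := fun k => zpow_ne_zero k two_ne_zero
  choose D hD using fun k : ℤ => exists_sobW_comp_smul_le (n := n) hs0 (hpow (-k))
  refine ⟨∑ k ∈ I, K * D k, fun σ hσ hb => iSup_le fun j => ?_⟩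
  let h : Rmn m n → ℂ := fun ξ => Φ ((2 : ℝ) ^ j • ξ) * ζhat ξ
  let g : ℤ → Rmn m n → ℂ := fun k ξ => σ ((2 : ℝ) ^ j • ξ) * 𝓕 (⇑ψ) ((2 : ℝ) ^ (-k) • ξ)
  have hg : ∀ k, Integrable (g k) := fun k =>
    integrable_dilate_mul_fourier ψ hσ hb _ (hpow (-k))
  have hh : ContDiff ℝ (⊤ : ℕ∞) h := contDiff_dilate_mul hζsmooth hr₁ hζ hΦsmooth (hpow j)
  have hhB : ∀ l ξ, ‖iteratedFDeriv ℝ l h ξ‖ ≤ B l := hB _ (by positivity)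
  have hsupp : tsupport h ⊆ closedBall 0 r₂ := fun ξ hξ => by
    simpa using (tsupport_subset_annulus hζ (tsupport_mul_subset_right hξ)).2
  have hgh : ∀ k, Integrable fun ξ => g k ξ * h ξ := fun k => by
    refine (hg k).mul_bdd (c := B 0) hh.continuous.aestronglyMeasurable
      (Filter.Eventually.of_forall fun ξ => ?_)
    simpa using hhB 0 ξ
  have hdecomp : (fun ξ => σ ((2 : ℝ) ^ j • ξ) * Φ ((2 : ℝ) ^ j • ξ) * ζhat ξ) =
      fun ξ => ∑ k ∈ I, g k ξ * h ξ := by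
    ext ξ
    by_cases hz : ζhat ξ = 0
    · simp [h, hz]
    · have h1 := hI ξ (hζ ξ hz).1 (hζ ξ hz).2
      simp only [g, h]
      rw [← Finset.sum_mul, ← Finset.mul_sum, h1]
      ring
  have hgk : ∀ k, sobW s (g k) ≤ D k * mulBound s ψ σ := fun k => by
    have heq : g k = fun ξ => (fun ξ => σ ((2 : ℝ) ^ (j + k) • ξ) * 𝓕 (⇑ψ) ξ)
        ((2 : ℝ) ^ (-k) • ξ) := by
      ext ξ
      simp only [g]
      rw [smul_smul, ← zpow_add₀ two_ne_zero, add_neg_cancel_right]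
    rw [heq]
    refine (hD k fun ξ => σ ((2 : ℝ) ^ (j + k) • ξ) * 𝓕 (⇑ψ) ξ).trans ?_
    gcongr
    exact le_iSup (fun j : ℤ => sobW s fun ξ => σ ((2 : ℝ) ^ j • ξ) * 𝓕 (⇑ψ) ξ) (j + k)
  rw [hdecomp]
  calc sobW s (fun ξ => ∑ k ∈ I, g k ξ * h ξ)
      ≤ ∑ k ∈ I, sobW s (fun ξ => g k ξ * h ξ) := sobW_sum_le s I fun k _ => hgh k
    _ ≤ ∑ k ∈ I, (K * D k : ℝ≥0∞) * mulBound s ψ σ := by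
        refine Finset.sum_le_sum fun k _ => ?_
        rw [mul_assoc]
        exact (hK h hh hsupp hhB (g k) (hg k)).trans (by gcongr; exact hgk k)
    _ = _ := by
        rw [← Finset.sum_mul]
        push_cast
        rfl
end
end

section
/- Let s_1, …, s_m ≥ n/2, and let Δ(s) ⊂ [0,∞)^m be the set of all points (1/p_1, …, 1/p_m) ∈ [0,∞)^m such that ∑_{k∈J}(s_k/n − 1/p_k) ≥ −1/2 for every nonempty subset J ⊂ {1, …, m}. Then Δ(s) equals the convex hull of the point (0,…,0) together with all points (1/p_1, …, 1/p_m) such that each coordinate 1/p_i belongs to {0, s_i/n, s_i/n + 1/2} and exactly one coordinate equals s_i/n + 1/2. -/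
open MeasureTheory Real Metric Set Function SchwartzMap
open scoped ENNReal NNReal FourierTransform RealInnerProductSpace BigOperators

noncomputable section

open MLFM

/-- The points with all coordinates in `{0, a i, a i + 1/2}`, exactly one of them being
`a i + 1/2`. -/
def peakedPoints {ι : Type*} (a : ι → ℝ) : Set (ι → ℝ) :=
  {x | (∀ i, x i = 0 ∨ x i = a i ∨ x i = a i + 1/2) ∧ ∃! i, x i = a i + 1/2}

theorem mem_convexHull_pair_zero {b y : ℝ} (h0 : 0 ≤ y) (hb : y ≤ b) :
    y ∈ convexHull ℝ ({0, b} : Set ℝ) := by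
  rw [convexHull_pair, segment_eq_Icc (h0.trans hb)]
  exact ⟨h0, hb⟩

theorem mem_peakedPoints_of_single_peak {ι : Type*} {a : ι → ℝ} (ha : ∀ i, 0 ≤ a i)
    {x : ι → ℝ} (k : ι)
    (hk : x k = a k + 1/2) (h : ∀ i, i ≠ k → x i = 0 ∨ x i = a i) : x ∈ peakedPoints a := by
  refine ⟨fun i => ?_, k, hk, fun i hi => ?_⟩
  · by_cases hik : i = k
    · subst hik; exact Or.inr (Or.inr hk)
    · rcases h i hik with h | h <;> simp [h]
  · by_contra hik
    have := ha i
    rcases h i hik with h | h <;> linarith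

section

variable {ι : Type*} [Fintype ι] [DecidableEq ι] {a : ι → ℝ}

/-- Raising one coordinate of a point of the box `[0, a]` to its peak value stays in the hull. -/
theorem update_mem_convexHull_peakedPoints (ha : ∀ i, 0 ≤ a i) {y : ι → ℝ}
    (h0 : ∀ i, 0 ≤ y i) (hy : ∀ i, y i ≤ a i) (k : ι) :
    Function.update y k (a k + 1/2) ∈ convexHull ℝ (insert 0 (peakedPoints a)) := by
  let t : ι → Set ℝ := Function.update (fun i => {0, a i}) k {a k + 1/2}
  have hsub : (Set.univ.pi t) ⊆ insert 0 (peakedPoints a) := by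
    intro v hv
    refine Or.inr (mem_peakedPoints_of_single_peak ha k ?_ fun i hik => ?_)
    · simpa [t] using hv k trivial
    · simpa [t, hik] using hv i trivial
  refine convexHull_mono hsub ?_
  rw [convexHull_pi]
  intro i _
  by_cases hik : i = k
  · subst hik; simp [t]
  · simpa [t, hik] using mem_convexHull_pair_zero (h0 i) (hy i)

theorem piecewise_mem_convexHull_peakedPoints (ha : ∀ i, 0 ≤ a i) (T : Finset ι) :
    (fun i => if i ∈ T then a i else 0) ∈ convexHull ℝ (insert 0 (peakedPoints a)) := by
  induction T using Finset.induction_on with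
  | empty => exact subset_convexHull ℝ _ (Or.inl (by ext; simp))
  | insert j T hj ih =>
    have hpeak := update_mem_convexHull_peakedPoints ha
      (y := fun i => if i ∈ T then a i else 0)
      (fun i => by split_ifs <;> simp [ha i])
      (fun i => by split_ifs <;> simp [ha i]) j
    have haj : 0 < 2 * a j + 1 := by linarith [ha j]
    have hc := convex_convexHull ℝ (insert 0 (peakedPoints a)) ih hpeak
      (a := 1 / (2 * a j + 1)) (b := 2 * a j / (2 * a j + 1)) (by positivity)
      (div_nonneg (by linarith [ha j]) haj.le) (by field_simp; ring)
    convert hc using 1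
    ext i
    by_cases hij : i = j
    · subst hij
      simp only [Finset.mem_insert_self, if_true, Pi.add_apply, Pi.smul_apply, smul_eq_mul, hj,
        if_false, Function.update_self, mul_zero, zero_add]
      rw [div_mul_eq_mul_div, eq_div_iff haj.ne']
      ring
    · simp only [Finset.mem_insert, hij, false_or, Pi.add_apply, Pi.smul_apply, smul_eq_mul, ne_eq,
        not_false_eq_true, Function.update_of_ne]
      field_simp
      ring

/-- The box `[0, a]` lies in the hull. -/
theorem box_mem_convexHull_peakedPoints (ha : ∀ i, 0 ≤ a i) {y : ι → ℝ}
    (h0 : ∀ i, 0 ≤ y i) (hy : ∀ i, y i ≤ a i) :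
    y ∈ convexHull ℝ (insert 0 (peakedPoints a)) := by
  have hbox : y ∈ convexHull ℝ (Set.univ.pi fun i => ({0, a i} : Set ℝ)) := by
    rw [convexHull_pi]
    exact fun i _ => mem_convexHull_pair_zero (h0 i) (hy i)
  refine convexHull_min (fun v hv => ?_) (convex_convexHull ℝ _) hbox
  convert piecewise_mem_convexHull_peakedPoints ha {i | v i = a i} using 1
  ext i
  rcases hv i trivial with h | h
  · by_cases hi : v i = a i <;> simp_all
  · simp_all

theorem mem_convexHull_peakedPoints (ha : ∀ i, 0 ≤ a i) {x : ι → ℝ} (h0 : ∀ i, 0 ≤ x i)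
    (hx : ∑ i, max (x i - a i) 0 ≤ 1/2) :
    x ∈ convexHull ℝ (insert 0 (peakedPoints a)) := by
  let y : ι → ℝ := fun i => min (x i) (a i)
  let t : ι → ℝ := fun i => 2 * max (x i - a i) 0
  have hy0 : ∀ i, 0 ≤ y i := fun i => le_min (h0 i) (ha i)
  have hya : ∀ i, y i ≤ a i := fun i => min_le_right _ _
  have ht : ∑ i, t i ≤ 1 := by
    simp only [t, ← Finset.mul_sum]
    linarith
  have hmem := (convex_convexHull ℝ (insert 0 (peakedPoints a))).sum_mem
    (t := Finset.univ) (w := fun o : Option ι => o.elim (1 - ∑ i, t i) t)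
    (z := fun o => o.elim y fun k => Function.update y k (a k + 1/2))
    (by
      rintro (_ | k) -
      · simpa using ht
      · simp [t])
    (by simp [Fintype.sum_option])
    (by
      rintro (_ | k) -
      · exact box_mem_convexHull_peakedPoints ha hy0 hya
      · exact update_mem_convexHull_peakedPoints ha hy0 hya k)
  convert hmem using 1
  ext i
  have hupd : ∀ k, t k * Function.update y k (a k + 1/2) i
      = t k * y i + if k = i then t i * (a i + 1/2 - y i) else 0 := by
    intro k
    by_cases hik : k = i
    · subst hik; simp; ring
    · simp [hik, Function.update_of_ne (Ne.symm hik)]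
  simp only [Fintype.sum_option, Option.elim, Pi.smul_apply, smul_eq_mul,
    Finset.sum_apply, hupd, Finset.sum_add_distrib, ← Finset.sum_mul, Finset.sum_ite_eq',
    Finset.mem_univ, if_true]
  rcases le_total (x i) (a i) with h | h
  · simp only [y, t, min_eq_left h, max_eq_right (sub_nonpos.2 h)]
    ring
  · simp only [y, t, min_eq_right h, max_eq_left (sub_nonneg.2 h)]
    ring

end

theorem convexHull_peakedPoints {ι : Type*} [Fintype ι] {a : ι → ℝ} (ha : ∀ i, 0 ≤ a i) :
    {x : ι → ℝ | (∀ i, 0 ≤ x i) ∧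
        ∀ J : Finset ι, J.Nonempty → -(1/2 : ℝ) ≤ ∑ k ∈ J, (a k - x k)} =
      convexHull ℝ (insert 0 (peakedPoints a)) := by
  classical
  apply Set.Subset.antisymm
  · rintro x ⟨h0, hJ⟩
    refine mem_convexHull_peakedPoints ha h0 ?_
    have hsum : ∑ i, max (x i - a i) 0 = -∑ k with a k ≤ x k, (a k - x k) := by
      rw [Finset.sum_filter, ← Finset.sum_neg_distrib]
      refine Finset.sum_congr rfl fun i _ => ?_
      split_ifs with h
      · rw [max_eq_left (sub_nonneg.2 h)]; ring
      · rw [max_eq_right (by linarith)]; simp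
    rw [hsum]
    rcases ({k | a k ≤ x k} : Finset ι).eq_empty_or_nonempty with h | h
    · rw [h]; norm_num
    · linarith [hJ _ h]
  · apply convexHull_min
    · rintro x (rfl | ⟨hx, k, hk, huniq⟩)
      · refine ⟨fun _ => le_rfl, fun J _ => ?_⟩
        have := Finset.sum_nonneg fun i (_ : i ∈ J) => ha i
        simp only [Pi.zero_apply, sub_zero]
        linarith
      · refine ⟨fun i => ?_, fun J _ => ?_⟩
        · have := ha i
          rcases hx i with h | h | h <;> linarith
        · have hle : ∑ i ∈ J, (if i = k then -(1/2 : ℝ) else 0) ≤ ∑ i ∈ J, (a i - x i) := by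
            refine Finset.sum_le_sum fun i _ => ?_
            split_ifs with hik
            · subst hik; linarith
            · have := ha i
              rcases hx i with h | h | h
              · linarith
              · linarith
              · exact absurd (huniq i h) hik
          refine le_trans ?_ hle
          rw [Finset.sum_ite_eq']
          split_ifs <;> norm_num
    · rintro x ⟨hx, hxJ⟩ y ⟨hy, hyJ⟩ c d hc hd hcd
      refine ⟨fun i => add_nonneg (mul_nonneg hc (hx i)) (mul_nonneg hd (hy i)), fun J hJ => ?_⟩
      have hcomb : ∑ k ∈ J, (a k - (c • x + d • y) k)
          = c * ∑ k ∈ J, (a k - x k) + d * ∑ k ∈ J, (a k - y k) := by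
        rw [Finset.mul_sum, Finset.mul_sum, ← Finset.sum_add_distrib]
        refine Finset.sum_congr rfl fun k _ => ?_
        simp only [Pi.add_apply, Pi.smul_apply, smul_eq_mul]
        linear_combination (-a k) * hcd
      rw [hcomb]
      have h1 := mul_le_mul_of_nonneg_left (hxJ J hJ) hc
      have h2 := mul_le_mul_of_nonneg_left (hyJ J hJ) hd
      have h3 : c * -(1/2 : ℝ) + d * -(1/2) = -(1/2) := by linear_combination -(1/2) * hcd
      linarith

/-- Lemma 3.7: for `s_i ≥ n/2`, the region
`Δ(s) = {x ∈ [0,∞)^m : ∑_{k∈J}(s_k/n − x_k) ≥ −1/2 for all nonempty J}` is the convex hull of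
the origin and the points whose coordinates lie in `{0, s_i/n, s_i/n + 1/2}` with exactly one
coordinate equal to `s_i/n + 1/2`. -/
theorem delta_s_eq_convexHull
    (m n : ℕ) (hn : 0 < n)
    (s : Fin m → ℝ) (hs : ∀ i, (n : ℝ) / 2 ≤ s i) :
    {x : Fin m → ℝ | (∀ i, 0 ≤ x i) ∧
        ∀ J : Finset (Fin m), J.Nonempty →
          -(1/2 : ℝ) ≤ ∑ k ∈ J, (s k / (n : ℝ) - x k)} =
      convexHull ℝ (insert (0 : Fin m → ℝ)
        {x : Fin m → ℝ |
          (∀ i, x i = 0 ∨ x i = s i / (n : ℝ) ∨ x i = s i / (n : ℝ) + 1/2) ∧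
          ∃! i, x i = s i / (n : ℝ) + 1/2}) := by
  exact convexHull_peakedPoints fun i =>
    div_nonneg ((by positivity : (0 : ℝ) ≤ (n : ℝ) / 2).trans (hs i)) n.cast_nonneg
end
end
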